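/- Fix an integer p ≥ 2 and define ν : ℤ → ℝ by ν(2p-2) = 2^{2p-1}/(p·C(2p,p)), ν(-2l) = 4^{-l}·(p-1)·C(2l,l)/((p+l-1)(2l-1)) for every integer l ≥ 1, and ν(k) = 0 for all other k ∈ ℤ. Then ν is a probability distribution on ℤ (its values are nonnegative and sum to 1), h_1^{(1)} is ν-harmonic on ℤ_{>0}, and 𝓛_ν = 4(p-1)/3. -/

import Mathlib

open scoped BigOperators

noncomputable def h0 (r : ℝ) (l : ℤ) : ℝ :=
  if 0 ≤ l then
    (4 : ℝ) ^ (-l) *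
      ∑ m ∈ Finset.range (l.toNat + 1),
        (Nat.choose (2 * m) m : ℝ) * (Nat.choose (2 * (l.toNat - m)) (l.toNat - m) : ℝ) *
          (-r) ^ (l.toNat - m)
  else 0

noncomputable def h1 (r : ℝ) (l : ℤ) : ℝ :=
  if 1 ≤ l then ∑ p ∈ Finset.range l.toNat, h0 r (p : ℤ) else 0

noncomputable def h2 (r : ℝ) (l : ℤ) : ℝ :=
  if 2 ≤ l then ∑ p ∈ Finset.Icc 1 (l.toNat - 1), h1 r (p : ℤ) else 0

noncomputable def hm1 (r : ℝ) (l : ℤ) : ℝ := h0 r (l + 1) - h0 r l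

noncomputable def hm2 (r : ℝ) (l : ℤ) : ℝ := hm1 r (l + 1) - hm1 r l

noncomputable def kernelR (r : ℝ) (k m : ℤ) : ℝ :=
  ∑ p ∈ Finset.range m.toNat,
    h1 r (m - (p : ℤ)) * (hm2 r (k + (p : ℤ) - 1) + r * hm2 r (k + (p : ℤ) - 2))

/-- `ν` is a probability distribution on `ℤ`. -/
def IsProbDist (ν : ℤ → ℝ) : Prop := (∀ k, 0 ≤ ν k) ∧ HasSum ν 1

/-- A nonnegative function `f : ℤ → [0,∞)` is `ν`-harmonic on `ℤ_{>0}`. -/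
def NuHarmonic (ν : ℤ → ℝ) (f : ℤ → ℝ) : Prop :=
  (∀ l, 0 ≤ f l) ∧ ∀ k : ℤ, 1 ≤ k → HasSum (fun l : ℤ => f (k + l) * ν l) (f k)

noncomputable def Lnu (r : ℝ) (ν : ℤ → ℝ) : ℝ :=
  ∑' k : ℕ, ν ((k : ℤ) + 1) * h2 r ((k : ℤ) + 2)

noncomputable def phiNu (ν : ℤ → ℝ) (θ : ℝ) : ℂ :=
  ∑' k : ℤ, (ν k : ℂ) * Complex.exp (Complex.I * (k : ℂ) * (θ : ℂ))

/-- The step distribution of the peeling random walk of critical `2p`-angulations: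
`ν(2p-2) = 2^{2p-1}/(p C(2p,p))`, `ν(-2l) = 4^{-l}(p-1)C(2l,l)/((p+l-1)(2l-1))` for `l ≥ 1`,
and `ν(k) = 0` otherwise. -/
noncomputable def nuPoly (p : ℕ) : ℤ → ℝ := fun k =>
  if k = 2 * (p : ℤ) - 2 then
    (2 : ℝ) ^ (2 * p - 1) / ((p : ℝ) * (Nat.choose (2 * p) p : ℝ))
  else if k < 0 ∧ (2 : ℤ) ∣ k then
    let l : ℕ := (-k).toNat / 2
    (4 : ℝ) ^ (-(l : ℤ)) * ((p : ℝ) - 1) * (Nat.choose (2 * l) l : ℝ) /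
      (((p : ℝ) + (l : ℝ) - 1) * (2 * (l : ℝ) - 1))
  else 0

noncomputable def aa (n : ℕ) : ℝ := (Nat.choose (2 * n) n : ℝ) / 4 ^ n

theorem aa_zero : aa 0 = 1 := by simp [aa]

theorem aa_pos (n : ℕ) : 0 < aa n := by
  unfold aa
  have : 0 < Nat.choose (2 * n) n := Nat.choose_pos (by omega)
  positivity

theorem aa_succ (n : ℕ) : (2 * (n : ℝ) + 2) * aa (n + 1) = (2 * n + 1) * aa n := by
  have h := Nat.succ_mul_centralBinom_succ n
  rw [Nat.centralBinom_eq_two_mul_choose, Nat.centralBinom_eq_two_mul_choose] at h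
  have h' : ((n : ℝ) + 1) * (Nat.choose (2 * (n + 1)) (n + 1) : ℝ)
      = 2 * (2 * n + 1) * (Nat.choose (2 * n) n : ℝ) := by exact_mod_cast h
  unfold aa
  rw [pow_succ]
  field_simp
  linear_combination 2 * h'

theorem aa_le_one (n : ℕ) : aa n ≤ 1 := by
  induction n with
  | zero => simp [aa_zero]
  | succ n ih =>
    have h := aa_succ n
    have h2 := aa_pos (n + 1)
    have h3 := aa_pos n
    have hn : (0 : ℝ) ≤ n := Nat.cast_nonneg n
    by_contra hc
    push Not at hc
    nlinarith

noncomputable def bb (n : ℕ) : ℝ := 2 * n * aa n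

theorem bb_succ (n : ℕ) : bb (n + 1) = (2 * n + 1) * aa n := by
  unfold bb; push_cast; linear_combination aa_succ n

theorem bb_rec (n : ℕ) : 2 * (n : ℝ) * bb (n + 1) = (2 * n + 1) * bb n := by
  rw [bb_succ]; unfold bb; ring

theorem bb_pos (n : ℕ) : 0 < bb (n + 1) := by
  rw [bb_succ]
  have := aa_pos n
  positivity

theorem bb_nonneg (n : ℕ) : 0 ≤ bb n := by
  unfold bb
  have := aa_pos n
  positivity

theorem sum_aa (n : ℕ) : ∑ m ∈ Finset.range n, aa m = bb n := by
  induction n with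
  | zero => simp [bb]
  | succ n ih => rw [Finset.sum_range_succ, ih, bb_succ]; unfold bb; ring

theorem sum_bb (n : ℕ) : ∑ m ∈ Finset.range (n + 1), bb m = 2 * n / 3 * bb (n + 1) := by
  induction n with
  | zero => simp [bb]
  | succ n ih =>
    rw [Finset.sum_range_succ, ih]
    have := bb_rec (n + 1)
    push_cast at this ⊢
    linear_combination (-1 / 3) * this

/-- coefficients of `(1-x)^(1/2)` -/
noncomputable def cc (n : ℕ) : ℝ := - aa n / (2 * n - 1)

theorem odd_ne (n : ℕ) : (2 * (n : ℝ) - 1) ≠ 0 := by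
  intro h
  have h1 : (2 * (n : ℝ)) = 1 := by linarith
  have h2 : 2 * n = 1 := by exact_mod_cast h1
  omega

theorem cc_zero : cc 0 = 1 := by simp [cc, aa_zero]

theorem cc_succ (n : ℕ) : (2 * (n : ℝ) + 2) * cc (n + 1) = (2 * n - 1) * cc n := by
  have h := aa_succ n
  have h1 := odd_ne n
  have h2 := odd_ne (n + 1)
  unfold cc
  push_cast at h2 ⊢
  field_simp
  have h3 : 2 * ((n : ℝ) + 1) - 1 = 2 * n + 1 := by ring
  rw [h3] 
  linear_combination (-1) * h

theorem conv_partial (n L : ℕ) (hL : L ≤ n) :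
    (n : ℝ) * ∑ l ∈ Finset.range L, cc l * aa (n - l)
      = - ((L : ℝ) * (2 * (n - L : ℕ) + 1) * (cc L * aa (n - L))) := by
  induction L with
  | zero => simp
  | succ L ih =>
    obtain ⟨m, rfl⟩ := Nat.exists_eq_add_of_le hL
    have e1 : L + 1 + m - L = m + 1 := by omega
    have e2 : L + 1 + m - (L + 1) = m := by omega
    rw [Finset.sum_range_succ, mul_add, ih (by omega), e1, e2]
    have h1 := aa_succ m
    have h2 := cc_succ L
    push_cast
    linear_combination (-cc L * (L - 1 / 2)) * h1 + (2 * m + 1) / 2 * aa m * h2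

theorem conv_zero (n : ℕ) (hn : 1 ≤ n) :
    ∑ l ∈ Finset.range (n + 1), cc l * aa (n - l) = 0 := by
  have h := conv_partial n n le_rfl
  have hn' : (n : ℝ) ≠ 0 := by positivity
  apply mul_left_cancel₀ hn'
  rw [Finset.sum_range_succ, mul_add, h]
  simp

theorem step_id (q n l : ℕ) (hq : 1 ≤ q) (hl : l ≤ n) :
    ((n : ℝ) + q) * (bb (n + 1 - l) * cc l / (q + l))
      = (n + q + 1 / 2) * (bb (n - l) * cc l / (q + l)) + cc l * aa (n - l) := by
  obtain ⟨m, rfl⟩ := Nat.exists_eq_add_of_le hl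
  have e1 : l + m + 1 - l = m + 1 := by omega
  have e2 : l + m - l = m := by omega
  rw [e1, e2, bb_succ]
  unfold bb
  have : (q : ℝ) + l ≠ 0 := by positivity
  push_cast
  field_simp
  ring

theorem harm (q n : ℕ) (hq : 1 ≤ q) :
    ∑ l ∈ Finset.range (n + 1), bb (n + 1 - l) * (q * cc l / (q + l))
      = bb (n + 1 + q) / bb (q + 1) := by
  induction n with
  | zero =>
    have := (bb_pos q).ne'
    have hq' : (q : ℝ) ≠ 0 := by positivity
    have h1 : bb 1 = 1 := by simpa [aa_zero] using bb_succ 0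
    simp [cc_zero, h1]
    rw [div_self hq', add_comm 1 q, div_self this]
  | succ n ih =>
    have h1 : ((n : ℝ) + 1 + q) * ∑ l ∈ Finset.range (n + 1 + 1), bb (n + 1 + 1 - l) * (q * cc l / (q + l))
      = (n + 1 + q + 1 / 2) * ∑ l ∈ Finset.range (n + 1 + 1), bb (n + 1 - l) * (q * cc l / (q + l)) := by
      have h0 := conv_zero (n + 1) (by omega)
      have : ((n : ℝ) + 1 + q) * ∑ l ∈ Finset.range (n + 1 + 1), bb (n + 1 + 1 - l) * (q * cc l / (q + l))
        = (n + 1 + q + 1 / 2) * ∑ l ∈ Finset.range (n + 1 + 1), bb (n + 1 - l) * (q * cc l / (q + l))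
          + q * ∑ l ∈ Finset.range (n + 1 + 1), cc l * aa (n + 1 - l) := by
        rw [Finset.mul_sum, Finset.mul_sum, Finset.mul_sum, ← Finset.sum_add_distrib]
        apply Finset.sum_congr rfl
        intro l hl
        have := step_id q (n + 1) l hq (by simp at hl; omega)
        push_cast at this
        linear_combination (q : ℝ) * this
      rw [this, h0]; ring
    rw [Finset.sum_range_succ (fun l => bb (n + 1 - l) * (q * cc l / ((q : ℝ) + l))) (n + 1)] at h1
    rw [ih] at h1
    have hb0 : bb (n + 1 - (n + 1)) = 0 := by simp [bb]
    rw [hb0, zero_mul, add_zero] at h1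
    have h2 := bb_rec (n + 1 + q)
    have e : n + 1 + 1 + q = n + 1 + q + 1 := by omega
    have hne : ((n : ℝ) + 1 + q) ≠ 0 := by positivity
    have hb := (bb_pos q).ne'
    apply mul_left_cancel₀ hne
    rw [h1, e]
    push_cast at h2
    field_simp
    linear_combination (-1) * h2

theorem cc_tendsto : Filter.Tendsto cc Filter.atTop (nhds 0) := by
  rw [← Filter.tendsto_add_atTop_iff_nat 1]
  apply squeeze_zero_norm (a := fun n : ℕ => 1 / ((n : ℝ) + 1)) _ tendsto_one_div_add_atTop_nhds_zero_nat
  intro n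
  have h1 := aa_pos (n + 1)
  have h2 := aa_le_one (n + 1)
  have e : cc (n + 1) = - (aa (n + 1) / (2 * n + 1)) := by
    unfold cc; push_cast; rw [neg_div]; congr 2; ring
  rw [e, norm_neg, Real.norm_of_nonneg (by positivity)]
  have hn : (0 : ℝ) ≤ n := Nat.cast_nonneg n
  apply div_le_div₀ <;> linarith

theorem partI (q L : ℕ) (hq : 1 ≤ q) :
    q * ∑ l ∈ Finset.range (L + 1), cc l / (q + l)
      - (q + 3 / 2) * ∑ l ∈ Finset.range L, cc l / (q + 1 + l) = cc L := by
  induction L with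
  | zero =>
    have hq' : (q : ℝ) ≠ 0 := by positivity
    simp [cc_zero, hq']
  | succ L ih =>
    rw [Finset.sum_range_succ _ (L + 1), Finset.sum_range_succ (fun l : ℕ => cc l / ((q : ℝ) + 1 + l)) L]
    have h := cc_succ L
    have h1 : (q : ℝ) + 1 + L ≠ 0 := by positivity
    have h2 : (q : ℝ) + (L + 1 : ℕ) = q + 1 + L := by push_cast; ring
    rw [h2]
    have : q * (cc (L + 1) / (q + 1 + L)) - (q + 3 / 2) * (cc L / (q + 1 + L))
        = cc (L + 1) - cc L := by
      field_simp
      linear_combination (-1) * h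
    linear_combination ih + this

theorem partI1 (L : ℕ) :
    (3 / 2 : ℝ) * ∑ l ∈ Finset.range L, cc l / (1 + l) = 1 - cc L := by
  induction L with
  | zero => simp [cc_zero]
  | succ L ih =>
    rw [Finset.sum_range_succ, mul_add, ih]
    have h := cc_succ L
    have h1 : (1 : ℝ) + L ≠ 0 := by positivity
    field_simp
    linear_combination h

theorem tendI (q : ℕ) :
    Filter.Tendsto (fun L => ∑ l ∈ Finset.range L, cc l / ((q : ℝ) + 1 + l)) Filter.atTop
      (nhds (1 / ((q + 1) * bb (q + 2)))) := by
  induction q with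
  | zero =>
    have h : Filter.Tendsto (fun L => (2 / 3 : ℝ) * (1 - cc L)) Filter.atTop (nhds (2 / 3 * (1 - 0))) :=
      (tendsto_const_nhds.sub cc_tendsto).const_mul _
    have hb : bb 2 = 3 / 2 := by
      have := bb_rec 1
      have h1 := bb_succ 0
      simp [aa_zero] at h1
      norm_num [h1] at this
      linarith
    convert h using 1
    · ext L
      rw [← partI1 L]
      simp only [Nat.cast_zero, zero_add]
      ring
    · simp [hb]
  | succ q ih =>
    have h : Filter.Tendsto (fun L => (1 / ((q : ℝ) + 1 + 3 / 2)) *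
        ((q + 1) * (∑ l ∈ Finset.range (L + 1), cc l / ((q : ℝ) + 1 + l)) - cc L)) Filter.atTop
        (nhds ((1 / ((q : ℝ) + 1 + 3 / 2)) * ((q + 1) * (1 / ((q + 1) * bb (q + 2))) - 0))) :=
      ((((Filter.tendsto_add_atTop_iff_nat 1).2 ih).const_mul _).sub cc_tendsto).const_mul _
    convert h using 1
    · ext L
      have := partI (q + 1) L (by omega)
      have h1 : (q : ℝ) + 1 + 3 / 2 ≠ 0 := by positivity
      push_cast at this ⊢
      rw [← this]
      field_simp
      ring
    · have h2 := bb_rec (q + 2)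
      have h3 := (bb_pos (q + 1)).ne'
      have h4 := (bb_pos (q + 2)).ne'
      have h1 : (q : ℝ) + 1 + 3 / 2 ≠ 0 := by positivity
      have h5 : (q : ℝ) + 1 ≠ 0 := by positivity
      have h6 : (q : ℝ) + 1 + 1 ≠ 0 := by positivity
      congr 1
      push_cast at h2 ⊢
      have e : q + 1 + 2 = q + 2 + 1 := by omega
      have e' : q + 1 + 1 = q + 2 := by omega
      rw [e]
      rw [e'] at h3
      field_simp
      linear_combination (-1) * h2

/-! ### the functions h -/

open PowerSeries in
theorem conv_sign (n : ℕ) :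
    ((n : ℝ) + 2) * (∑ m ∈ Finset.range (n + 2 + 1), aa m * ((-1) ^ (n + 2 - m) * aa (n + 2 - m)))
      = (n + 1) * (∑ m ∈ Finset.range (n + 1), aa m * ((-1) ^ (n - m) * aa (n - m))) := by
  let A : PowerSeries ℝ := PowerSeries.mk aa
  let B : PowerSeries ℝ := PowerSeries.mk (fun n => (-1) ^ n * aa n)
  have hA : (1 - X) * PowerSeries.derivative ℝ A = C (1 / 2 : ℝ) * A := by
    ext n
    rw [sub_mul, one_mul, map_sub, coeff_C_mul, PowerSeries.coeff_derivative]
    cases n with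
    | zero =>
      have := aa_succ 0
      simp [A] at this ⊢
      linarith
    | succ n =>
      rw [coeff_succ_X_mul, PowerSeries.coeff_derivative]
      have := aa_succ (n + 1)
      simp only [A, coeff_mk]
      push_cast at this ⊢
      linear_combination (1 / 2) * this
  have hB : (1 + X) * PowerSeries.derivative ℝ B = - (C (1 / 2 : ℝ) * B) := by
    ext n
    rw [add_mul, one_mul, map_add, map_neg, coeff_C_mul, PowerSeries.coeff_derivative]
    cases n with
    | zero =>
      have := aa_succ 0
      simp [B] at this ⊢
      linarith
    | succ n =>
      rw [coeff_succ_X_mul, PowerSeries.coeff_derivative]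
      have := aa_succ (n + 1)
      simp only [B, coeff_mk]
      push_cast at this ⊢
      rw [pow_succ, pow_succ]
      linear_combination (1 / 2) * (-1) ^ n * this
  have hC : (C (1 / 2 : ℝ) : PowerSeries ℝ) + C (1 / 2 : ℝ) = 1 := by
    rw [← map_add]; norm_num
  have hP : PowerSeries.derivative ℝ (A * B) = X * (A * B) + X * (X * PowerSeries.derivative ℝ (A * B)) := by
    have hd : PowerSeries.derivative ℝ (A * B) = A * PowerSeries.derivative ℝ B + B * PowerSeries.derivative ℝ A := by
      rw [Derivation.leibniz]; simp [smul_eq_mul]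
    rw [hd]
    linear_combination (1 + X) * B * hA + (1 - X) * A * hB + X * A * B * hC
  have hco : ∀ n, coeff n (A * B) = ∑ m ∈ Finset.range (n + 1), aa m * ((-1) ^ (n - m) * aa (n - m)) := by
    intro n
    rw [coeff_mul, Finset.Nat.sum_antidiagonal_eq_sum_range_succ_mk]
    simp [A, B]
  have h := congrArg (coeff (n + 1)) hP
  rw [map_add, coeff_succ_X_mul, coeff_succ_X_mul, PowerSeries.coeff_derivative, hco, hco] at h
  cases n with
  | zero =>
    simp at h ⊢
    linarith
  | succ n =>
    rw [coeff_succ_X_mul, PowerSeries.coeff_derivative, hco] at h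
    push_cast at h ⊢
    linear_combination h

theorem h0_eq (n : ℕ) : h0 1 (n : ℤ) =
    ∑ m ∈ Finset.range (n + 1), aa m * ((-1) ^ (n - m) * aa (n - m)) := by
  unfold h0
  simp only [Int.natCast_nonneg, if_true, Int.toNat_natCast]
  rw [Finset.mul_sum]
  apply Finset.sum_congr rfl
  intro m hm
  have hm' : m ≤ n := by simp at hm; omega
  obtain ⟨k, rfl⟩ := Nat.exists_eq_add_of_le hm'
  have e : m + k - m = k := by omega
  rw [e, zpow_neg, zpow_natCast, pow_add]
  unfold aa
  field_simp

theorem h0_rec (n : ℕ) : ((n : ℝ) + 2) * h0 1 ((n + 2 : ℕ) : ℤ) = (n + 1) * h0 1 (n : ℤ) := by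
  rw [h0_eq, h0_eq]; exact conv_sign n

theorem h0_even_odd (n : ℕ) : h0 1 ((2 * n : ℕ) : ℤ) = aa n ∧ h0 1 ((2 * n + 1 : ℕ) : ℤ) = 0 := by
  induction n with
  | zero =>
    constructor
    · rw [h0_eq]; simp [aa_zero]
    · rw [h0_eq]; simp [Finset.sum_range_succ]; ring
  | succ n ih =>
    constructor
    · have h := h0_rec (2 * n)
      rw [ih.1] at h
      have h2 := aa_succ n
      have h3 : (2 * (n : ℝ) + 2) ≠ 0 := by positivity
      apply mul_left_cancel₀ h3
      rw [h2]
      push_cast at h ⊢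
      rw [← h]; ring_nf
    · have h := h0_rec (2 * n + 1)
      rw [ih.2] at h
      have h3 : (2 * (n : ℝ) + 1 + 2) ≠ 0 := by positivity
      apply mul_left_cancel₀ h3
      rw [mul_zero] at h ⊢
      push_cast at h ⊢
      rw [← h]; ring_nf

theorem sum_h0 (n : ℕ) : ∑ p ∈ Finset.range (2 * n), h0 1 (p : ℤ) = bb n := by
  induction n with
  | zero => simp [bb]
  | succ n ih =>
    rw [show 2 * (n + 1) = 2 * n + 1 + 1 by ring, Finset.sum_range_succ, Finset.sum_range_succ, ih,
      (h0_even_odd n).1, (h0_even_odd n).2, bb_succ]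
    unfold bb; ring

theorem h1_even (n : ℕ) : h1 1 ((2 * n : ℕ) : ℤ) = bb n := by
  unfold h1
  rw [Int.toNat_natCast, sum_h0]
  split_ifs with h
  · rfl
  · have : n = 0 := by push_cast at h; omega
    subst this; simp [bb]

theorem h1_odd (n : ℕ) : h1 1 ((2 * n + 1 : ℕ) : ℤ) = bb (n + 1) := by
  unfold h1
  rw [Int.toNat_natCast, if_pos (by push_cast; omega), ← sum_h0,
    show 2 * (n + 1) = 2 * n + 1 + 1 by ring, Finset.sum_range_succ _ (2 * n + 1), (h0_even_odd n).2, add_zero]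

theorem h1_neg (k : ℤ) (h : k ≤ 0) : h1 1 k = 0 := by
  unfold h1; rw [if_neg (by omega)]

theorem h1_sum (q : ℕ) : ∑ p ∈ Finset.range (2 * q + 1), h1 1 (p : ℤ) = 2 * ∑ m ∈ Finset.range (q + 1), bb m := by
  induction q with
  | zero => simp [bb, h1]
  | succ q ih =>
    rw [show 2 * (q + 1) + 1 = 2 * q + 1 + 1 + 1 by ring, Finset.sum_range_succ, Finset.sum_range_succ, ih,
      Finset.sum_range_succ _ (q + 1), h1_odd, show 2 * q + 1 + 1 = 2 * (q + 1) by ring, h1_even]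
    ring

theorem h2_eq (q : ℕ) (hq : 1 ≤ q) : h2 1 ((2 * q + 1 : ℕ) : ℤ) = 4 * q / 3 * bb (q + 1) := by
  unfold h2
  rw [if_pos (by push_cast; omega), Int.toNat_natCast]
  have := h1_sum q
  rw [Finset.range_eq_Ico, Finset.sum_eq_sum_Ico_succ_bot (by omega)] at this
  have e : Finset.Icc 1 (2 * q + 1 - 1) = Finset.Ico (0 + 1) (2 * q + 1) := by
    ext x; simp only [Finset.mem_Icc, Finset.mem_Ico]; omega
  rw [e]
  rw [sum_bb] at this
  have h0 : h1 1 ((0 : ℕ) : ℤ) = 0 := h1_neg _ (by simp)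
  rw [h0] at this
  linear_combination this

/-! ### nu -/

def gmap (q : ℕ) (n : ℕ) : ℤ := if n = 0 then 2 * (q : ℤ) else -2 * (n : ℤ)

theorem gmap_inj (q : ℕ) : Function.Injective (gmap q) := by
  intro a b h
  unfold gmap at h
  split_ifs at h <;> omega

theorem nu_top (q : ℕ) : nuPoly (q + 1) (2 * (q : ℤ)) = 1 / bb (q + 1) := by
  unfold nuPoly
  rw [if_pos (by push_cast; ring)]
  unfold bb aa
  have : 0 < Nat.choose (2 * (q + 1)) (q + 1) := Nat.choose_pos (by omega)
  rw [show 2 * (q + 1) - 1 = 2 * q + 1 by omega, pow_succ, pow_mul, pow_succ]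
  push_cast
  field_simp
  norm_num
  ring

theorem nu_neg (q : ℕ) (n : ℕ) :
    nuPoly (q + 1) (-2 * ((n + 1 : ℕ) : ℤ)) = - (q * cc (n + 1) / (q + (n + 1 : ℕ))) := by
  unfold nuPoly
  rw [if_neg (by push_cast; omega), if_pos (by constructor; push_cast; omega; exact ⟨-((n + 1 : ℕ) : ℤ), by ring⟩)]
  have e : (-(-2 * ((n + 1 : ℕ) : ℤ))).toNat / 2 = n + 1 := by omega
  simp only [e]
  unfold cc aa
  have h := odd_ne (n + 1)
  have h2 : (q : ℝ) + (n + 1 : ℕ) ≠ 0 := by positivity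
  rw [zpow_neg, zpow_natCast]
  have e2 : (((q + 1 : ℕ) : ℝ) + (n + 1 : ℕ) - 1) = q + (n + 1 : ℕ) := by push_cast; ring
  have e3 : (((q + 1 : ℕ) : ℝ) - 1) = q := by push_cast; ring
  rw [e2, e3]
  field_simp

theorem nu_other (q : ℕ) (k : ℤ) (hk : k ∉ Set.range (gmap q)) : nuPoly (q + 1) k = 0 := by
  unfold nuPoly
  rw [if_neg, if_neg]
  · rintro ⟨h1, m, rfl⟩
    apply hk
    refine ⟨(-m).toNat, ?_⟩
    unfold gmap
    rw [if_neg (by omega)]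
    omega
  · rintro rfl
    exact hk ⟨0, by simp [gmap]; ring⟩

theorem cc_neg (n : ℕ) : cc (n + 1) ≤ 0 := by
  have h1 := aa_pos (n + 1)
  have e : cc (n + 1) = - (aa (n + 1) / (2 * n + 1)) := by
    unfold cc; push_cast; rw [neg_div]; congr 2; ring
  rw [e]
  have : 0 ≤ aa (n + 1) / (2 * n + 1) := by positivity
  linarith

theorem nu_neg_nonneg (q n : ℕ) : 0 ≤ - (q * cc (n + 1) / ((q : ℝ) + (n + 1 : ℕ))) := by
  have h := cc_neg n
  rw [← neg_div, ← mul_neg]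
  have : 0 ≤ - cc (n + 1) := by linarith
  positivity

theorem nu_nonneg (q : ℕ) (k : ℤ) : 0 ≤ nuPoly (q + 1) k := by
  by_cases hk : k ∈ Set.range (gmap q)
  · obtain ⟨n, rfl⟩ := hk
    cases n with
    | zero =>
      have := bb_pos q
      simp only [gmap, if_true]
      rw [nu_top]; positivity
    | succ n =>
      simp only [gmap, Nat.succ_ne_zero, if_false]
      rw [nu_neg]; exact nu_neg_nonneg q n
  · rw [nu_other q k hk]

theorem nu_hasSum (q : ℕ) (f : ℤ → ℝ) (s : ℝ)
    (h : HasSum (fun n : ℕ => f (-2 * ((n + 1 : ℕ) : ℤ)) * - (q * cc (n + 1) / ((q : ℝ) + (n + 1 : ℕ)))) (s - f (2 * q) / bb (q + 1))) :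
    HasSum (fun k => f k * nuPoly (q + 1) k) s := by
  rw [← (gmap_inj q).hasSum_iff (by intro x hx; rw [nu_other q x hx, mul_zero])]
  rw [← hasSum_nat_add_iff' 1]
  have e1 : (fun n : ℕ => ((fun k => f k * nuPoly (q + 1) k) ∘ gmap q) (n + 1)) =
      fun n : ℕ => f (-2 * ((n + 1 : ℕ) : ℤ)) * - (q * cc (n + 1) / ((q : ℝ) + (n + 1 : ℕ))) := by
    ext n
    simp only [gmap, Function.comp, Nat.succ_ne_zero, if_false]
    rw [nu_neg]
  have e2 : ∑ i ∈ Finset.range 1, ((fun k => f k * nuPoly (q + 1) k) ∘ gmap q) i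
      = f (2 * q) / bb (q + 1) := by
    simp [gmap, nu_top]; ring
  rw [e1, e2]
  exact h

theorem nu_prob (q : ℕ) (hq : 1 ≤ q) : HasSum (nuPoly (q + 1)) 1 := by
  have := nu_hasSum q (fun _ => 1) 1 ?_
  · simpa using this
  simp only [one_mul]
  rw [hasSum_iff_tendsto_nat_of_nonneg (nu_neg_nonneg q)]
  obtain ⟨r, rfl⟩ := Nat.exists_eq_add_of_le' hq
  have h := tendI r
  rw [← Filter.tendsto_add_atTop_iff_nat 1] at h
  have h2 := (h.const_mul ((r : ℝ) + 1)).const_sub 1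
  have hr : (r : ℝ) + 1 ≠ 0 := by positivity
  convert h2 using 1
  · ext L
    rw [Finset.sum_range_succ', mul_add, Finset.mul_sum]
    simp only [cc_zero, Nat.cast_zero, add_zero, Finset.sum_neg_distrib]
    rw [mul_one_div_cancel hr, sub_add_cancel_right]
    congr 1
    apply Finset.sum_congr rfl
    intro l _
    push_cast; ring
  · have := (bb_pos (r + 1)).ne'
    congr 2
    field_simp

theorem harm_gen (q n : ℕ) (hq : 1 ≤ q) (k : ℤ)
    (hk : ∀ m : ℕ, h1 1 (k + -2 * (m : ℤ)) = bb (n + 1 - m)) (hk2 : h1 1 (k + 2 * q) = bb (n + 1 + q)) :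
    HasSum (fun l : ℤ => h1 1 (k + l) * nuPoly (q + 1) l) (h1 1 k) := by
  apply nu_hasSum q (fun l => h1 1 (k + l))
  have h := harm q n hq
  have hq' : (q : ℝ) ≠ 0 := by positivity
  have h0 := hk 0
  simp only [Nat.cast_zero, mul_zero, add_zero, Nat.sub_zero] at h0
  rw [hk2, ← h, Finset.sum_range_succ', h0]
  simp only [hk]
  have : bb (n + 1) - (∑ l ∈ Finset.range n, bb (n + 1 - (l + 1)) * (q * cc (l + 1) / ((q : ℝ) + (l + 1 : ℕ)))
      + bb (n + 1 - 0) * (q * cc 0 / (q + (0 : ℕ)))) =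
      ∑ l ∈ Finset.range n, bb (n + 1 - (l + 1)) * -(q * cc (l + 1) / ((q : ℝ) + (l + 1 : ℕ))) := by
    simp only [mul_neg, Finset.sum_neg_distrib, cc_zero, Nat.cast_zero, add_zero, mul_one, div_self hq', Nat.sub_zero]
    ring
  rw [this]
  apply hasSum_sum_of_ne_finset_zero
  intro b hb
  have : n + 1 - (b + 1) = 0 := by simp at hb; omega
  rw [this]; simp [bb]

theorem nu_harm (q : ℕ) (hq : 1 ≤ q) (k : ℤ) (hk : 1 ≤ k) :
    HasSum (fun l : ℤ => h1 1 (k + l) * nuPoly (q + 1) l) (h1 1 k) := by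
  obtain ⟨j, rfl⟩ := Int.eq_ofNat_of_zero_le (by omega : 0 ≤ k)
  rcases Nat.even_or_odd' j with ⟨n, rfl | rfl⟩
  · obtain ⟨n, rfl⟩ := Nat.exists_eq_add_of_le' (by omega : 1 ≤ n)
    apply harm_gen q n hq
    · intro m
      by_cases hm : m ≤ n + 1
      · rw [← h1_even]; congr 1; push_cast [hm]; ring
      · rw [h1_neg _ (by push_cast; omega), Nat.sub_eq_zero_of_le (by omega)]; simp [bb]
    · rw [← h1_even]; congr 1; push_cast; ring
  · apply harm_gen q n hq
    · intro m
      by_cases hm : m ≤ n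
      · rw [show n + 1 - m = (n - m) + 1 by omega, ← h1_odd]; congr 1; push_cast [hm]; ring
      · rw [h1_neg _ (by push_cast; omega), Nat.sub_eq_zero_of_le (by omega)]; simp [bb]
    · rw [show n + 1 + q = (n + q) + 1 by omega, ← h1_odd]; congr 1; push_cast; ring

theorem h1_nonneg (k : ℤ) : 0 ≤ h1 1 k := by
  by_cases hk : k ≤ 0
  · rw [h1_neg k hk]
  obtain ⟨j, rfl⟩ := Int.eq_ofNat_of_zero_le (by omega : 0 ≤ k)
  rcases Nat.even_or_odd' j with ⟨n, rfl | rfl⟩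
  · exact (h1_even n).symm ▸ bb_nonneg _
  · exact (h1_odd n).symm ▸ bb_nonneg _

/-- `2p`-angulations. -/
theorem stmt18 (p : ℕ) (hp : 2 ≤ p) :
    IsProbDist (nuPoly p) ∧
    NuHarmonic (nuPoly p) (h1 1) ∧
    (∑' k : ℕ, nuPoly p ((k : ℤ) + 1) * h2 1 ((k : ℤ) + 2)) = 4 * ((p : ℝ) - 1) / 3 := by

  obtain ⟨q, rfl⟩ := Nat.exists_eq_add_of_le' (by omega : 1 ≤ p)
  have hq : 1 ≤ q := by omega
  refine ⟨⟨nu_nonneg q, nu_prob q hq⟩, ⟨h1_nonneg, nu_harm q hq⟩, ?_⟩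
  rw [tsum_eq_single (2 * q - 1)]
  · have e1 : ((2 * q - 1 : ℕ) : ℤ) + 1 = 2 * (q : ℤ) := by omega
    have e2 : ((2 * q - 1 : ℕ) : ℤ) + 2 = ((2 * q + 1 : ℕ) : ℤ) := by omega
    rw [e1, e2, nu_top, h2_eq q hq]
    have := (bb_pos q).ne'
    push_cast
    field_simp
    ring
  · intro b hb
    rw [nu_other, zero_mul]
    rintro ⟨n, hn⟩
    unfold gmap at hn
    split_ifs at hn <;> omega
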